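/- Let F be a field, let ℓ ≥ 1, m_A ≥ 1, m_B ≥ 1 be integers with gcd(ℓ·m_A, m_B) = 1, and let a, b be integers with a·ℓ·m_A + b·m_B = 1. Let g^A ∈ F[X] divide X^{m_A} − 1 and let f_0 = 1, f_1, …, f_{ℓ−1} ∈ F[X]. Let M be an m_B × (ℓ·m_A) matrix over F such that every row of M is a codeword of the 1-level ℓ-quasi-cyclic code generated by (g^A, g^A f_1, …, g^A f_{ℓ−1}): that is, for every 0 ≤ i < m_B there exists ε_i(X) ∈ F[X] such that, for all 0 ≤ h < ℓ, the polynomial a_{i,h}(X) = Σ_{j=0}^{m_A−1} M_{i,jℓ+h} X^j satisfies a_{i,h}(X) ≡ ε_i(X)·g^A(X)·f_h(X) (mod X^{m_A} − 1). Let R = F[X]/(X^{m_A·m_B} − 1) with X̄ the (unit) image of X and v = X̄^{b·m_B}. Then for every 0 ≤ h < ℓ, the element Σ_{i=0}^{m_B−1} Σ_{j=0}^{m_A−1} M_{i, jℓ+h} · X̄^{i·a·ℓ·m_A + j·b·m_B} of R lies in the ideal of R generated by g^A(v)·f_h(v). -/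

import Mathlib

open Polynomial

theorem mk_X_pow_eq_one (F : Type*) [Field F] (N : ℕ) :
    (Ideal.Quotient.mk (Ideal.span {(X : Polynomial F) ^ N - 1}) (X ^ N)) = 1 := by
  have hmem : (X : Polynomial F) ^ N - 1 ∈ Ideal.span {(X : Polynomial F) ^ N - 1} :=
    Ideal.subset_span rfl
  have h0 := Ideal.Quotient.eq_zero_iff_mem.mpr hmem
  rw [map_sub, map_one, sub_eq_zero] at h0
  exact h0

/-- The image `X̄` of `X` in `F[X]/(X^N − 1)`, as a unit of that ring. -/
noncomputable def Xu (F : Type*) [Field F] (N : ℕ) (hN : 0 < N) :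
    (Polynomial F ⧸ Ideal.span {(X : Polynomial F) ^ N - 1})ˣ where
  val := Ideal.Quotient.mk _ X
  inv := Ideal.Quotient.mk _ (X ^ (N - 1))
  val_inv := by
    rw [← map_mul, ← pow_succ', Nat.sub_add_cancel hN]
    exact mk_X_pow_eq_one F N
  inv_val := by
    rw [← map_mul, ← pow_succ, Nat.sub_add_cancel hN]
    exact mk_X_pow_eq_one F N

/-- The index `j·ℓ + h` as an element of `Fin (ℓ·m_A)`. -/
def idx {ℓ mA : ℕ} (j : Fin mA) (h : Fin ℓ) : Fin (ℓ * mA) :=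
  ⟨(j : ℕ) * ℓ + (h : ℕ), by
    calc (j : ℕ) * ℓ + (h : ℕ) < (j : ℕ) * ℓ + ℓ := Nat.add_lt_add_left h.isLt _
    _ = ((j : ℕ) + 1) * ℓ := by ring
    _ ≤ mA * ℓ := Nat.mul_le_mul_right ℓ j.isLt
    _ = ℓ * mA := Nat.mul_comm mA ℓ⟩


theorem Xu_pow_eq_one (F : Type*) [Field F] (N : ℕ) (hN : 0 < N) : Xu F N hN ^ N = 1 := by
  ext
  rw [Units.val_pow_eq_pow_val, Units.val_one, ← mk_X_pow_eq_one F N, map_pow]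
  rfl

/-- If every row of the codeword matrix `M` lies in the 1-level `ℓ`-quasi-cyclic
code with generator `(g^A, g^A f_1, …, g^A f_{ℓ−1})`, then each serialized
component sum lies in the ideal of `R = F[X]/(X^{m_A·m_B} − 1)` generated by
`g^A(v)·f_h(v)`, where `v = X̄^{b·m_B}`. -/
theorem component_in_row_code_ideal (F : Type*) [Field F]
    (ℓ mA mB : ℕ) (hℓ : 1 ≤ ℓ) (hmA : 1 ≤ mA) (hmB : 1 ≤ mB)
    (hgcd : Nat.gcd (ℓ * mA) mB = 1) (a b : ℤ) (hab : a * ℓ * mA + b * mB = 1)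
    (gA : Polynomial F) (hgA : gA ∣ X ^ mA - 1)
    (f : Fin ℓ → Polynomial F) (hf0 : f ⟨0, hℓ⟩ = 1)
    (M : Fin mB → Fin (ℓ * mA) → F)
    (hrowcode : ∀ i : Fin mB, ∃ ε : Polynomial F, ∀ h : Fin ℓ,
      (X ^ mA - 1 : Polynomial F) ∣
        ((∑ j : Fin mA, C (M i (idx j h)) * X ^ (j : ℕ)) - ε * gA * f h)) :
    ∀ h : Fin ℓ,
      (∑ i : Fin mB, ∑ j : Fin mA,
        Ideal.Quotient.mk (Ideal.span {(X : Polynomial F) ^ (mA * mB) - 1})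
            (C (M i (idx j h))) *
          ↑(Xu F (mA * mB) (Nat.mul_pos hmA hmB) ^
            ((i : ℤ) * a * ℓ * mA + (j : ℤ) * b * mB))) ∈
      Ideal.span {(Polynomial.aeval
          (↑(Xu F (mA * mB) (Nat.mul_pos hmA hmB) ^ (b * mB)) :
            Polynomial F ⧸ Ideal.span {(X : Polynomial F) ^ (mA * mB) - 1}) gA) *
        (Polynomial.aeval
          (↑(Xu F (mA * mB) (Nat.mul_pos hmA hmB) ^ (b * mB)) :
            Polynomial F ⧸ Ideal.span {(X : Polynomial F) ^ (mA * mB) - 1}) (f h))} := by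
  intro h
  have hN : 0 < mA * mB := Nat.mul_pos hmA hmB
  set u := Xu F (mA * mB) hN with hu
  set v := u ^ (b * mB) with hv
  have hvA : v ^ mA = 1 := by
    rw [hv, ← zpow_natCast, ← zpow_mul,
      show b * (mB : ℤ) * (mA : ℤ) = ((mA * mB : ℕ) : ℤ) * b by push_cast; ring,
      zpow_mul, zpow_natCast, hu, Xu_pow_eq_one, one_zpow]
  refine Ideal.sum_mem _ fun i _ => ?_
  obtain ⟨ε, hε⟩ := hrowcode i
  obtain ⟨q, hq⟩ := hε h
  have hrow := congrArg (aeval (v : F[X] ⧸ Ideal.span {(X : F[X]) ^ (mA * mB) - 1})) hq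
  have hvA' : (v : F[X] ⧸ Ideal.span {(X : F[X]) ^ (mA * mB) - 1}) ^ mA = 1 := by
    rw [← Units.val_pow_eq_pow_val, hvA, Units.val_one]
  simp only [map_sub, map_mul, map_sum, map_pow, aeval_X, map_one, hvA', sub_self, zero_mul,
    aeval_C, sub_eq_zero] at hrow
  refine Ideal.mem_span_singleton.mpr ⟨↑(u ^ ((i : ℤ) * a * ℓ * mA)) * aeval ↑v ε, ?_⟩
  have hsplit : ∀ j : Fin mA,
      Ideal.Quotient.mk (Ideal.span {(X : F[X]) ^ (mA * mB) - 1}) (C (M i (idx j h))) *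
        ↑(u ^ ((i : ℤ) * a * ℓ * mA + (j : ℤ) * b * mB)) =
      ↑(u ^ ((i : ℤ) * a * ℓ * mA)) * (algebraMap F _ (M i (idx j h)) * ↑v ^ (j : ℕ)) := by
    intro j
    rw [zpow_add, Units.val_mul, show (j : ℤ) * b * mB = b * mB * (j : ℤ) by ring,
      zpow_mul u (b * mB), ← hv, zpow_natCast v, Units.val_pow_eq_pow_val]
    exact mul_left_comm _ _ _
  rw [Finset.sum_congr rfl fun j _ => hsplit j, ← Finset.mul_sum, hrow]
  ring
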